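/- arXiv:2603.03410 — 4 statements merged into one kernel-verified Lean document; each statement's English description precedes it below -/
import Mathlib

section
/- Let m, T be positive natural numbers and let C : Fin T × Fin m → ℝ satisfy 0 ≤ C(t,ℓ) ≤ 1 for all (t,ℓ). Let (g_{t,ℓ}) be an independent family of real random variables, where g_{t,ℓ} has probability density x ↦ C(t,ℓ) + 2(1 − C(t,ℓ))x on [0,1] (and 0 elsewhere). Define MS = (1/(mT)) · Σ_{t,ℓ} g_{t,ℓ}. Then E[MS] = (1/(mT)) · Σ_{t,ℓ} (4 − C(t,ℓ))/6, and Var[MS] = (1/(mT))² · Σ_{t,ℓ} [p_{t,ℓ}(1 − p_{t,ℓ}) − 1/6], where p_{t,ℓ} = (4 − C(t,ℓ))/6. -/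
open MeasureTheory ProbabilityTheory

lemma aux_integral {Ω : Type*} [MeasurableSpace Ω] (P : Measure Ω)
    (c : ℝ) (h0 : 0 ≤ c) (h1 : c ≤ 1) (g : Ω → ℝ) (hg : Measurable g)
    (hlaw : Measure.map g P = volume.withDensity (fun x => ENNReal.ofReal
        ((Set.Icc (0 : ℝ) 1).indicator (fun x => c + 2 * (1 - c) * x) x)))
    (f : ℝ → ℝ) (hf : Continuous f) :
    ∫ ω, f (g ω) ∂P = ∫ x in (0:ℝ)..1, (c + 2 * (1 - c) * x) * f x := by
  have hd : Measurable ((Set.Icc (0 : ℝ) 1).indicator (fun x => c + 2 * (1 - c) * x)) :=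
    Measurable.indicator (by fun_prop) measurableSet_Icc
  rw [← integral_map (φ := g) (f := f) hg.aemeasurable hf.aestronglyMeasurable, hlaw,
    integral_withDensity_eq_integral_toReal_smul hd.ennreal_ofReal
      (by simp),
    intervalIntegral.integral_of_le zero_le_one, ← integral_Icc_eq_integral_Ioc,
    ← integral_indicator measurableSet_Icc]
  congr 1
  ext x
  by_cases hx : x ∈ Set.Icc (0:ℝ) 1
  · have : 0 ≤ c + 2 * (1 - c) * x := by
      have := mul_nonneg (sub_nonneg.2 h1) hx.1
      linarith
    simp only [Set.indicator_of_mem hx, smul_eq_mul, ENNReal.toReal_ofReal this]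
  · simp only [Set.indicator_of_notMem hx]
    simp

lemma aux_memLp {Ω : Type*} [MeasurableSpace Ω] (P : Measure Ω) [IsProbabilityMeasure P]
    (c : ℝ) (g : Ω → ℝ) (hg : Measurable g)
    (hlaw : Measure.map g P = volume.withDensity (fun x => ENNReal.ofReal
        ((Set.Icc (0 : ℝ) 1).indicator (fun x => c + 2 * (1 - c) * x) x))) :
    MemLp g 2 P := by
  have h : ∀ᵐ x ∂(Measure.map g P), x ∈ Set.Icc (0:ℝ) 1 := by
    rw [hlaw, ae_withDensity_iff (Measurable.ennreal_ofReal
      (Measurable.indicator (by fun_prop) measurableSet_Icc))]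
    refine Filter.Eventually.of_forall fun x hx => ?_
    by_contra hn
    exact hx (by simp only [Set.indicator_of_notMem hn, ENNReal.ofReal_zero])
  have h' := ae_of_ae_map hg.aemeasurable h
  refine MemLp.of_bound hg.aestronglyMeasurable 1 ?_
  filter_upwards [h'] with ω hω
  rw [Real.norm_eq_abs, abs_of_nonneg hω.1]
  exact hω.2

lemma aux_mean (c : ℝ) : ∫ x in (0:ℝ)..1, (c + 2 * (1 - c) * x) * x = (4 - c) / 6 := by
  have : ∀ x : ℝ, (c + 2 * (1 - c) * x) * x = c * x ^ 1 + 2 * (1 - c) * x ^ 2 := by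
    intro x; ring
  simp_rw [this]
  rw [intervalIntegral.integral_add (Continuous.intervalIntegrable (by fun_prop) _ _)
    (Continuous.intervalIntegrable (by fun_prop) _ _), intervalIntegral.integral_const_mul,
    intervalIntegral.integral_const_mul, integral_pow, integral_pow]
  norm_num
  ring

lemma aux_sq (c : ℝ) : ∫ x in (0:ℝ)..1, (c + 2 * (1 - c) * x) * x ^ 2 = (3 - c) / 6 := by
  have : ∀ x : ℝ, (c + 2 * (1 - c) * x) * x ^ 2 = c * x ^ 2 + 2 * (1 - c) * x ^ 3 := by
    intro x; ring
  simp_rw [this]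
  rw [intervalIntegral.integral_add (Continuous.intervalIntegrable (by fun_prop) _ _)
    (Continuous.intervalIntegrable (by fun_prop) _ _), intervalIntegral.integral_const_mul,
    intervalIntegral.integral_const_mul, integral_pow, integral_pow]
  norm_num
  ring

/-- Expected value and variance of the mean score of watermarked text under the
Uniform(0,1) g-value distribution: the watermarked g-values `g (t,ℓ)` are independent
real random variables with density `x ↦ C (t,ℓ) + 2 (1 - C (t,ℓ)) x` on `[0,1]`
(and `0` elsewhere), and the mean score `MS = (1/(mT)) ∑ g (t,ℓ)` satisfies
`E[MS] = (1/(mT)) ∑ (4 - C (t,ℓ))/6` and `Var[MS] = (1/(mT))² ∑ (p (1-p) - 1/6)`. -/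
theorem meanScore_expectation_variance_uniform
    {Ω : Type*} [MeasurableSpace Ω] (P : Measure Ω) [IsProbabilityMeasure P]
    (m T : ℕ) (hm : 0 < m) (hT : 0 < T)
    (C : Fin T × Fin m → ℝ) (hC : ∀ i, 0 ≤ C i ∧ C i ≤ 1)
    (g : Fin T × Fin m → Ω → ℝ)
    (hgm : ∀ i, Measurable (g i))
    (hglaw : ∀ i, Measure.map (g i) P =
      volume.withDensity (fun x => ENNReal.ofReal
        ((Set.Icc (0 : ℝ) 1).indicator (fun x => C i + 2 * (1 - C i) * x) x)))
    (hindep : iIndepFun g P)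
    (MS : Ω → ℝ) (hMS : MS = fun ω => (1 / ((m : ℝ) * T)) * ∑ i, g i ω) :
    (∫ ω, MS ω ∂P) = (1 / ((m : ℝ) * T)) * ∑ i, (4 - C i) / 6 ∧
    variance MS P = (1 / ((m : ℝ) * T)) ^ 2 *
      ∑ i, (((4 - C i) / 6) * (1 - (4 - C i) / 6) - 1 / 6) := by
  have hL : ∀ i, MemLp (g i) 2 P := fun i => aux_memLp P (C i) (g i) (hgm i) (hglaw i)
  have hE : ∀ i, ∫ ω, g i ω ∂P = (4 - C i) / 6 := fun i => by
    rw [← aux_mean]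
    exact aux_integral P (C i) (hC i).1 (hC i).2 (g i) (hgm i) (hglaw i) (fun x => x) continuous_id
  have hE2 : ∀ i, ∫ ω, (g i ω) ^ 2 ∂P = (3 - C i) / 6 := fun i => by
    rw [← aux_sq]
    exact aux_integral P (C i) (hC i).1 (hC i).2 (g i) (hgm i) (hglaw i) (fun x => x ^ 2)
      (by fun_prop)
  subst hMS
  constructor
  · rw [integral_const_mul, integral_finsetSum _ (fun i _ => (hL i).integrable (by norm_num))]
    simp_rw [hE]
  · rw [variance_const_mul]
    congr 1
    have hs : (fun ω => ∑ i, g i ω) = ∑ i, g i := by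
      ext ω; simp
    rw [hs, IndepFun.variance_sum (fun i _ => hL i)
      (fun i _ j _ hij => hindep.indepFun hij)]
    refine Finset.sum_congr rfl fun i _ => ?_
    rw [variance_eq_sub (hL i)]
    simp only [Pi.pow_apply, hE, hE2]
    ring
end

section
/- Let Â, B̂, Ĉ, D̂ > 0 be real constants. The function k(m) = (Â√m − B̂)/√(Ĉm − D̂), defined for m > D̂/Ĉ, satisfies k'(m) = (B̂Ĉ√m − ÂD̂)/(2√m · (Ĉm − D̂)^{3/2}); in particular k is strictly increasing on the interval m > max(D̂/Ĉ, (ÂD̂/(B̂Ĉ))²), and consequently the function m ↦ 1 − Φ(k(m)) is strictly decreasing there. -/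
open MeasureTheory ProbabilityTheory

/-- The cumulative distribution function of the standard normal distribution N(0,1). -/
noncomputable def stdNormalCDF : ℝ → ℝ := fun x => cdf (gaussianReal 0 1) x

theorem stdNormalCDF_strictMono_aux : StrictMono (fun x => cdf (gaussianReal 0 1) x) := by
  intro a b hab
  simp only [cdf_eq_real]
  have h1 : (gaussianReal 0 1) (Set.Ioc a b) ≠ 0 := by
    intro h
    have h2 := gaussianReal_absolutelyContinuous' 0 (one_ne_zero) h
    rw [Real.volume_Ioc, ENNReal.ofReal_eq_zero] at h2
    linarith
  have h3 : (gaussianReal 0 1).real (Set.Iic b) =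
      (gaussianReal 0 1).real (Set.Iic a) + (gaussianReal 0 1).real (Set.Ioc a b) := by
    rw [← Set.Iic_union_Ioc_eq_Iic hab.le]
    refine measureReal_union ?_ measurableSet_Ioc
    exact Set.Iic_disjoint_Ioc le_rfl
  have h4 : 0 < (gaussianReal 0 1).real (Set.Ioc a b) :=
    ENNReal.toReal_pos h1 (measure_ne_top _ _)
  linarith

/-- Decreasing branch of the unimodality corollary for the mean score: for positive
constants `Â, B̂, Ĉ, D̂`, the function `k(m) = (Â√m − B̂)/√(Ĉm − D̂)` (defined for
`m > D̂/Ĉ`) has derivative `(B̂Ĉ√m − ÂD̂)/(2√m (Ĉm − D̂)^{3/2})`, is strictly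
increasing for `m > max (D̂/Ĉ) ((ÂD̂/(B̂Ĉ))²)`, and hence `m ↦ 1 − Φ(k m)` is strictly
decreasing there. -/
theorem tpr_decreasing_branch_meanScore
    (Ahat Bhat Chat Dhat : ℝ)
    (hA : 0 < Ahat) (hB : 0 < Bhat) (hC : 0 < Chat) (hD : 0 < Dhat) :
    (∀ m : ℝ, Dhat / Chat < m →
      HasDerivAt (fun x : ℝ => (Ahat * Real.sqrt x - Bhat) / Real.sqrt (Chat * x - Dhat))
        ((Bhat * Chat * Real.sqrt m - Ahat * Dhat) /
          (2 * Real.sqrt m * (Chat * m - Dhat) ^ ((3 : ℝ) / 2))) m) ∧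
    StrictMonoOn (fun m : ℝ => (Ahat * Real.sqrt m - Bhat) / Real.sqrt (Chat * m - Dhat))
      (Set.Ioi (max (Dhat / Chat) ((Ahat * Dhat / (Bhat * Chat)) ^ 2))) ∧
    StrictAntiOn
      (fun m : ℝ =>
        1 - stdNormalCDF ((Ahat * Real.sqrt m - Bhat) / Real.sqrt (Chat * m - Dhat)))
      (Set.Ioi (max (Dhat / Chat) ((Ahat * Dhat / (Bhat * Chat)) ^ 2))) := by
  have hder : ∀ m : ℝ, Dhat / Chat < m →
      HasDerivAt (fun x : ℝ => (Ahat * Real.sqrt x - Bhat) / Real.sqrt (Chat * x - Dhat))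
        ((Bhat * Chat * Real.sqrt m - Ahat * Dhat) /
          (2 * Real.sqrt m * (Chat * m - Dhat) ^ ((3 : ℝ) / 2))) m := by
    intro m hm
    have hm0 : 0 < m := lt_trans (by positivity) hm
    have hp : 0 < Chat * m - Dhat := by
      rw [div_lt_iff₀ hC] at hm
      linarith
    have hs := Real.sqrt_pos.2 hm0
    have ht := Real.sqrt_pos.2 hp
    have hs2 := Real.sq_sqrt hm0.le
    have ht2 := Real.sq_sqrt hp.le
    have h32 : (Chat * m - Dhat) ^ ((3 : ℝ) / 2) = Real.sqrt (Chat * m - Dhat) ^ 3 := by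
      rw [Real.sqrt_eq_rpow, ← Real.rpow_natCast, ← Real.rpow_mul hp.le]
      norm_num
    have h1 := ((Real.hasDerivAt_sqrt hm0.ne').const_mul Ahat).sub_const Bhat
    have h2 := ((((hasDerivAt_id m).const_mul Chat).sub_const Dhat).sqrt hp.ne')
    have h3 := h1.div h2 ht.ne'
    refine h3.congr_deriv ?_
    rw [h32]
    simp only [id]
    generalize Real.sqrt (Chat * m - Dhat) = t at *
    generalize Real.sqrt m = s at *
    subst hs2
    field_simp
    rw [ht2]
    ring
  have hmono : StrictMonoOn
      (fun m : ℝ => (Ahat * Real.sqrt m - Bhat) / Real.sqrt (Chat * m - Dhat))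
      (Set.Ioi (max (Dhat / Chat) ((Ahat * Dhat / (Bhat * Chat)) ^ 2))) := by
    refine strictMonoOn_of_deriv_pos (convex_Ioi _) ?_ ?_
    · intro x hx
      exact (hder x (lt_of_le_of_lt (le_max_left _ _) hx)).continuousAt.continuousWithinAt
    · intro x hx
      rw [interior_Ioi, Set.mem_Ioi] at hx
      have hm := lt_of_le_of_lt (le_max_left _ _) hx
      have hx2 := lt_of_le_of_lt (le_max_right _ _) hx
      rw [(hder x hm).deriv]
      have hm0 : 0 < x := lt_trans (by positivity) hm
      have hp : 0 < Chat * x - Dhat := by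
        rw [div_lt_iff₀ hC] at hm
        linarith
      have hs := Real.sqrt_pos.2 hm0
      have h5 := Real.lt_sqrt_of_sq_lt hx2
      rw [div_lt_iff₀ (by positivity)] at h5
      apply div_pos
      · linarith
      · have := Real.rpow_pos_of_pos hp ((3 : ℝ) / 2)
        positivity
  refine ⟨hder, hmono, ?_⟩
  intro x hx y hy hxy
  have := stdNormalCDF_strictMono_aux (hmono hx hy hxy)
  simp only [stdNormalCDF]
  simp only at this
  linarith
end

section
/- Let μ ∈ ℝ, σ > 0, α > 0, and let X be an almost surely positive real random variable such that log X ~ Normal(μ, σ²). Define Y = αX/(αX + 1). Then for every y ∈ (0,1), P(Y ≤ y) = Φ((ln(y/(α(1 − y))) − μ)/σ). -/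
open MeasureTheory ProbabilityTheory

/-- CDF of the Bayesian score: if `X` is almost surely positive with
`log X ~ Normal(μ, σ²)`, `σ > 0`, `α > 0`, and `Y = αX/(αX + 1)`, then for every
`y ∈ (0,1)`, `P(Y ≤ y) = Φ((ln(y/(α(1 − y))) − μ)/σ)`. -/
theorem bayesianScore_cdf_logNormal
    {Ω : Type*} [MeasurableSpace Ω] (P : Measure Ω) [IsProbabilityMeasure P]
    (μ σ : ℝ) (hσ : 0 < σ) (α : ℝ) (hα : 0 < α)
    (X : Ω → ℝ) (hXm : Measurable X) (hpos : ∀ᵐ ω ∂P, 0 < X ω)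
    (hlog : Measure.map (fun ω => Real.log (X ω)) P =
      gaussianReal μ ⟨σ ^ 2, sq_nonneg σ⟩)
    (Y : Ω → ℝ) (hY : Y = fun ω => α * X ω / (α * X ω + 1))
    (y : ℝ) (hy : y ∈ Set.Ioo (0 : ℝ) 1) :
    (P {ω | Y ω ≤ y}).toReal = stdNormalCDF ((Real.log (y / (α * (1 - y))) - μ) / σ) := by
  obtain ⟨hy0, hy1⟩ := hy
  have hm : Measurable (fun ω => Real.log (X ω)) := Real.measurable_log.comp hXm
  have hg : Measurable (fun x : ℝ => (x - μ) / σ) := by fun_prop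
  obtain ⟨v, hv, hlog⟩ : ∃ v : NNReal, (v : ℝ) = σ ^ 2 ∧
      Measure.map (fun ω => Real.log (X ω)) P = gaussianReal μ v := ⟨_, rfl, hlog⟩
  have hstd : (gaussianReal μ v).map (fun x => (x - μ) / σ)
      = gaussianReal 0 1 := by
    have h1 : (fun x : ℝ => (x - μ) / σ) = (fun x => x / σ) ∘ (fun x => x - μ) := rfl
    rw [h1, ← Measure.map_map (by fun_prop) (by fun_prop), gaussianReal_map_sub_const,
      gaussianReal_map_div_const]
    congr 1
    · simp
    · ext
      have : σ ^ 2 ≠ 0 := by positivity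
      rw [NNReal.coe_div, NNReal.coe_one, hv]
      exact div_self this
  unfold stdNormalCDF
  rw [cdf_eq_real, measureReal_def, ← hstd, ← hlog, Measure.map_map hg hm,
    Measure.map_apply (hg.comp hm) measurableSet_Iic]
  congr 1
  apply measure_congr
  filter_upwards [hpos] with ω hω
  apply propext
  change Y ω ≤ y ↔ (Real.log (X ω) - μ) / σ ≤ (Real.log (y / (α * (1 - y))) - μ) / σ
  have h1y : 0 < 1 - y := by linarith
  have hαX : 0 < α * X ω := by positivity
  rw [div_le_div_iff_of_pos_right hσ, sub_le_sub_iff_right,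
    Real.log_le_log_iff hω (by positivity), le_div_iff₀ (by positivity), hY]
  change α * X ω / (α * X ω + 1) ≤ y ↔ _
  rw [div_le_iff₀ (by positivity)]
  constructor <;> intro h <;> nlinarith
end

section
/- Let μ₀, μ_w ∈ ℝ, σ₀, σ_w > 0, α > 0, ε ∈ (0,1), and z ∈ ℝ with Φ(z) = 1 − ε. Let X be an almost surely positive real random variable with log X ~ Normal(μ_w, σ_w²), and define Y = αX/(αX + 1) and τ = 1 − 1/(1 + α·exp(μ₀ + zσ₀)). Then P(Y ≥ τ) = 1 − Φ((μ₀ + zσ₀ − μ_w)/σ_w). -/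
open MeasureTheory ProbabilityTheory

/-- Expected TPR at FPR = ε under the Bayesian score: if the watermarked
log-likelihood ratio satisfies `log X ~ Normal(μ_w, σ_w²)`, `Y = αX/(αX + 1)` is the
Bayesian score, and `τ = 1 − 1/(1 + α exp(μ₀ + zσ₀))` is the threshold calibrated to
the unwatermarked parameters, then `P(Y ≥ τ) = 1 − Φ((μ₀ + zσ₀ − μ_w)/σ_w)`. -/
theorem bayesianScore_tpr_at_fpr
    {Ω : Type*} [MeasurableSpace Ω] (P : Measure Ω) [IsProbabilityMeasure P]
    (μ₀ μw σ₀ σw α ε z : ℝ) (hσ₀ : 0 < σ₀) (hσw : 0 < σw) (hα : 0 < α)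
    (hε : ε ∈ Set.Ioo (0 : ℝ) 1) (hz : stdNormalCDF z = 1 - ε)
    (X : Ω → ℝ) (hXm : Measurable X) (hpos : ∀ᵐ ω ∂P, 0 < X ω)
    (hlog : Measure.map (fun ω => Real.log (X ω)) P =
      gaussianReal μw ⟨σw ^ 2, sq_nonneg σw⟩)
    (Y : Ω → ℝ) (hY : Y = fun ω => α * X ω / (α * X ω + 1))
    (τ : ℝ) (hτ : τ = 1 - 1 / (1 + α * Real.exp (μ₀ + z * σ₀))) :
    (P {ω | Y ω ≥ τ}).toReal = 1 - stdNormalCDF ((μ₀ + z * σ₀ - μw) / σw) := by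
  obtain ⟨v, hv, hlog⟩ : ∃ v : NNReal, (v : ℝ) = σw ^ 2 ∧
      Measure.map (fun ω => Real.log (X ω)) P = gaussianReal μw v :=
    ⟨⟨σw ^ 2, sq_nonneg σw⟩, rfl, hlog⟩
  have hlm : Measurable (fun ω => Real.log (X ω)) := Real.measurable_log.comp hXm
  have hmap : Measure.map (fun ω => (Real.log (X ω) - μw) / σw) P = gaussianReal 0 1 := by
    have h1 : Measure.map (fun x : ℝ => (x - μw) / σw)
        (Measure.map (fun ω => Real.log (X ω)) P) = gaussianReal 0 1 := by
      have hm1 : Measurable (fun x : ℝ => x - μw) := by fun_prop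
      have hm2 : Measurable (fun x : ℝ => x / σw) := by fun_prop
      have h2 : (fun x : ℝ => (x - μw) / σw) = (fun x => x / σw) ∘ (fun x => x - μw) := rfl
      rw [hlog, h2, ← Measure.map_map hm2 hm1, gaussianReal_map_sub_const,
        gaussianReal_map_div_const]
      congr 1
      · simp
      · ext
        rw [NNReal.coe_div, hv, NNReal.coe_one]
        exact div_self (by positivity)
    rw [Measure.map_map (by fun_prop) hlm] at h1
    exact h1
  set m := μ₀ + z * σ₀ with hm
  have hset : P {ω | Y ω ≥ τ} = gaussianReal 0 1 (Set.Ici ((m - μw) / σw)) := by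
    rw [← hmap, Measure.map_apply (by fun_prop) measurableSet_Ici]
    apply measure_congr
    filter_upwards [hpos] with ω hω
    apply propext
    change Y ω ≥ τ ↔ (m - μw) / σw ≤ (Real.log (X ω) - μw) / σw
    rw [div_le_div_iff_of_pos_right hσw, sub_le_sub_iff_right, Real.le_log_iff_exp_le hω, hY, hτ]
    have he := Real.exp_pos m
    have h1 : 0 < α * X ω + 1 := by positivity
    have h2 : 0 < 1 + α * Real.exp m := by positivity
    have h3 : α * X ω / (α * X ω + 1) = 1 - 1 / (α * X ω + 1) := by
      field_simp
      ring
    simp only [h3, ge_iff_le, sub_le_sub_iff_left]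
    rw [one_div_le_one_div h1 h2, add_comm, add_le_add_iff_right, mul_le_mul_iff_right₀ hα]
  haveI := nullSingletonClass_gaussianReal (μ := 0) (v := 1) one_ne_zero
  rw [hset, measure_congr Ioi_ae_eq_Ici.symm, ← Set.compl_Iic, stdNormalCDF, cdf_eq_real]
  exact probReal_compl_eq_one_sub measurableSet_Iic
end
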